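/- arXiv:2212.03571 — 2 statements merged into one kernel-verified Lean document; each statement's English description precedes it below -/
import Mathlib

section
/- Fix a natural number t. Let (G_n)_{n≥2} be a sequence of graphs where G_n is a connected simple graph on n vertices, and suppose that n·μ(G_n) → 0 as n → ∞. For each n let x_n be a unit Fiedler vector of G_n, and let r_n, s_n be vertices of G_n with dist_{G_n}(r_n, s_n) ≤ t. Then (x_n(r_n) − x_n(s_n))² / μ(G_n) → 0 as n → ∞ (note μ(G_n) > 0 since G_n is connected with n ≥ 2 vertices). -/
open Matrix Finset Filter

/-- The Laplacian quadratic form `xᵀ L(G) x`. -/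
noncomputable def lapQ {V : Type*} [Fintype V] (G : SimpleGraph V) (x : V → ℝ) : ℝ :=
  letI := Classical.decEq V
  letI : DecidableRel G.Adj := Classical.decRel _
  x ⬝ᵥ (G.lapMatrix ℝ *ᵥ x)

/-- The Laplacian matrix of `G` over `ℝ` (classical decidability). -/
noncomputable def lapMat {V : Type*} [Fintype V] (G : SimpleGraph V) : Matrix V V ℝ :=
  letI := Classical.decEq V
  letI : DecidableRel G.Adj := Classical.decRel _
  G.lapMatrix ℝ

/-- The algebraic connectivity `μ(G)`: the infimum of Rayleigh quotients of the Laplacian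
over nonzero vectors orthogonal to the all-ones vector. -/
noncomputable def algConn {V : Type*} [Fintype V] (G : SimpleGraph V) : ℝ :=
  sInf {r : ℝ | ∃ x : V → ℝ, x ≠ 0 ∧ (∑ v, x v) = 0 ∧ r = lapQ G x / (∑ v, (x v) ^ 2)}

theorem algConn_nonneg {V : Type*} [Fintype V] (G : SimpleGraph V) : 0 ≤ algConn G := by
  classical
  refine Real.sInf_nonneg ?_
  rintro _ ⟨x, -, -, rfl⟩
  refine div_nonneg ?_ (Finset.sum_nonneg fun v _ => sq_nonneg _)
  have h := (SimpleGraph.posSemidef_lapMatrix ℝ G).dotProduct_mulVec_nonneg x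
  rw [star_trivial] at h
  unfold lapQ
  convert h

open Classical in
theorem lapMat_mulVec_apply {V : Type*} [Fintype V] (G : SimpleGraph V) (x : V → ℝ) (v : V) :
    (lapMat G *ᵥ x) v = ∑ w, if G.Adj v w then x v - x w else 0 := by
  have h := G.lapMatrix_mulVec_apply (R := ℝ) v x
  have h' : (lapMat G *ᵥ x) v = G.degree v * x v - ∑ u ∈ G.neighborFinset v, x u := by
    rw [← h]
    unfold lapMat
    congr!
  rw [h', ← Finset.sum_filter, Finset.sum_sub_distrib, Finset.sum_const, nsmul_eq_mul,
    ← G.card_neighborFinset_eq_degree, G.neighborFinset_eq_filter]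

/-- Across any edge leaving a superlevel set, the drop of `x` is at most the total of `L(G) x`
over that set. -/
theorem sub_le_sum_lapMat_mulVec {V : Type*} [Fintype V] (G : SimpleGraph V) (x : V → ℝ)
    {u v : V} (huv : G.Adj u v) (hlt : x v < x u) :
    x u - x v ≤ ∑ w with x u ≤ x w, (lapMat G *ᵥ x) w := by
  classical
  set S : Finset V := {w | x u ≤ x w} with hS
  let f : V → V → ℝ := fun a b => if G.Adj a b then x a - x b else 0
  have hanti : ∀ a b, f a b = - f b a := fun a b => by
    simp only [f, G.adj_comm a b]
    split_ifs <;> ring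
  have hinner : ∑ a ∈ S, ∑ b ∈ S, f a b = 0 := by
    have h : ∑ a ∈ S, ∑ b ∈ S, f a b = - ∑ a ∈ S, ∑ b ∈ S, f a b := by
      conv_lhs => rw [Finset.sum_comm]
      simp only [← Finset.sum_neg_distrib]
      exact Finset.sum_congr rfl fun a _ => Finset.sum_congr rfl fun b _ => hanti b a
    linarith
  have hpos : ∀ a ∈ S, ∀ b ∈ Sᶜ, 0 ≤ f a b := fun a ha b hb => by
    simp only [hS, Finset.mem_filter, Finset.mem_univ, true_and, Finset.mem_compl, not_le] at ha hb
    simp only [f]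
    split_ifs <;> linarith
  have hu : u ∈ S := by simp [hS]
  have hv : v ∈ Sᶜ := by simp [hS, hlt]
  calc x u - x v = f u v := by simp [f, huv]
    _ ≤ ∑ b ∈ Sᶜ, f u b := Finset.single_le_sum (hpos u hu) hv
    _ ≤ ∑ a ∈ S, ∑ b ∈ Sᶜ, f a b :=
      Finset.single_le_sum (f := fun a => ∑ b ∈ Sᶜ, f a b)
        (fun a ha => Finset.sum_nonneg (hpos a ha)) hu
    _ = ∑ a ∈ S, ∑ b ∈ S, f a b + ∑ a ∈ S, ∑ b ∈ Sᶜ, f a b := by rw [hinner, zero_add]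
    _ = ∑ a ∈ S, (lapMat G *ᵥ x) a := by
      rw [← Finset.sum_add_distrib]
      refine Finset.sum_congr rfl fun a _ => ?_
      rw [Finset.sum_add_sum_compl, lapMat_mulVec_apply]

theorem sub_le_of_adj_of_lapMat_mulVec_eq {V : Type*} [Fintype V] {G : SimpleGraph V}
    {x : V → ℝ} {c : ℝ} (hc : 0 ≤ c) (hunit : ∑ v, x v ^ 2 = 1) (heig : lapMat G *ᵥ x = c • x)
    {u v : V} (huv : G.Adj u v) : x u - x v ≤ c * √(Fintype.card V) := by
  rcases le_or_gt (x u) (x v) with h | h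
  · have : 0 ≤ c * √(Fintype.card V) := by positivity
    linarith
  refine (sub_le_sum_lapMat_mulVec G x huv h).trans ?_
  simp only [heig, Pi.smul_apply, smul_eq_mul, ← Finset.mul_sum]
  refine mul_le_mul_of_nonneg_left (Real.le_sqrt_of_sq_le ?_) hc
  set S : Finset V := {w | x u ≤ x w}
  calc (∑ w ∈ S, x w) ^ 2 ≤ #S * ∑ w ∈ S, x w ^ 2 := sq_sum_le_card_mul_sum_sq
    _ ≤ Fintype.card V * ∑ w, x w ^ 2 := by
      gcongr
      · exact Finset.card_le_univ S
      · exact Finset.subset_univ S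
    _ = Fintype.card V := by rw [hunit, mul_one]

theorem SimpleGraph.Walk.abs_sub_le_length_mul {V : Type*} {G : SimpleGraph V} {x : V → ℝ} {d : ℝ}
    (h : ∀ u v, G.Adj u v → x u - x v ≤ d) {u v : V} (p : G.Walk u v) :
    |x u - x v| ≤ p.length * d := by
  induction p with
  | nil => simp
  | @cons a b c hab p ih =>
    have h₁ : |x a - x b| ≤ d := abs_sub_le_iff.2 ⟨h _ _ hab, h _ _ hab.symm⟩
    have h₂ := abs_sub_le (x a) (x b) (x c)
    rw [SimpleGraph.Walk.length_cons]
    push_cast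
    linarith

theorem sq_sub_div_le_of_lapMat_mulVec_eq {V : Type*} [Fintype V] {G : SimpleGraph V}
    (hconn : G.Connected) {x : V → ℝ} {c : ℝ} (hc : 0 ≤ c) (hunit : ∑ v, x v ^ 2 = 1)
    (heig : lapMat G *ᵥ x = c • x) {t : ℕ} {u v : V} (hdist : G.dist u v ≤ t) :
    (x u - x v) ^ 2 / c ≤ t ^ 2 * (Fintype.card V * c) := by
  rcases hc.eq_or_lt with rfl | hc'
  · simp
  obtain ⟨p, hp⟩ := hconn.exists_walk_length_eq_dist u v
  have hw := p.abs_sub_le_length_mul fun a b => sub_le_of_adj_of_lapMat_mulVec_eq hc hunit heig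
  have hle : |x u - x v| ≤ t * (c * √(Fintype.card V)) :=
    hw.trans (by rw [hp]; gcongr)
  rw [div_le_iff₀ hc', ← sq_abs]
  calc |x u - x v| ^ 2 ≤ (t * (c * √(Fintype.card V))) ^ 2 := by gcongr
    _ = t ^ 2 * (Fintype.card V * c) * c := by
      rw [mul_pow, mul_pow, Real.sq_sqrt (Nat.cast_nonneg _)]
      ring

/-- fix `t`. If `G_n` is connected on `n ≥ 2` vertices, `n·μ(G_n) → 0`,
`x_n` is a unit Fiedler vector, and `r_n, s_n` are at distance at most `t`, then
`(x_n(r_n) − x_n(s_n))²/μ(G_n) → 0`. -/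
theorem statement4 (t : ℕ) (G : (n : ℕ) → SimpleGraph (Fin (n + 2)))
    (hconn : ∀ n, (G n).Connected)
    (x : (n : ℕ) → Fin (n + 2) → ℝ)
    (hunit : ∀ n, ∑ v, (x n v) ^ 2 = 1)
    (heig : ∀ n, lapMat (G n) *ᵥ x n = algConn (G n) • x n)
    (hmu : Tendsto (fun n => ((n + 2 : ℕ) : ℝ) * algConn (G n)) atTop (nhds 0))
    (r s : (n : ℕ) → Fin (n + 2)) (hdist : ∀ n, (G n).dist (r n) (s n) ≤ t) :
    Tendsto (fun n => (x n (r n) - x n (s n)) ^ 2 / algConn (G n)) atTop (nhds 0) := by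
  refine squeeze_zero (fun n => div_nonneg (sq_nonneg _) (algConn_nonneg _)) (fun n => ?_)
    (by simpa only [mul_zero] using hmu.const_mul ((t : ℝ) ^ 2))
  simpa only [Fintype.card_fin] using
    sq_sub_div_le_of_lapMat_mulVec_eq (hconn n) (algConn_nonneg _) (hunit n) (heig n) (hdist n)
end

section
/- For every integer d ≥ 3 and all real numbers c ≥ 0 and ε > 0, there exists N such that the following holds: every connected simple graph G on n ≥ N vertices with minimum degree exactly d and diam(G) ≥ 3n/(d+1) − c satisfies μ(G) ≥ (1−ε)·(d−1)·π²/n². -/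
open Matrix Finset Filter

/-- The spectral gap `2 - 2 cos (π / P)` of the path is at least `1 / (P² / π² + 1 / 4)`. -/
theorem one_le_pathGap_mul (P : ℕ) (hP : 2 ≤ P) :
    1 ≤ (2 - 2 * Real.cos (Real.pi / P)) * ((P : ℝ) ^ 2 / Real.pi ^ 2 + 1 / 4) := by
  have hP' : (2 : ℝ) ≤ P := by exact_mod_cast hP
  have hpi := Real.pi_pos
  obtain ⟨t, ht⟩ : ∃ t : ℝ, t = Real.pi / (2 * P) := ⟨_, rfl⟩
  have ht0 : 0 < t := by rw [ht]; positivity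
  have ht1 : t ≤ 1 := by
    rw [ht, div_le_one (by positivity)]
    linarith [Real.pi_lt_four]
  have hP2 : (P : ℝ) ^ 2 / Real.pi ^ 2 = 1 / (4 * t ^ 2) := by
    rw [ht]; field_simp; ring
  have hcos : 2 - 2 * Real.cos (Real.pi / P) = 4 * Real.sin t ^ 2 := by
    have : Real.pi / P = 2 * t := by rw [ht]; field_simp
    rw [this, Real.cos_two_mul, Real.cos_sq']
    ring
  rw [hcos, hP2]
  have hs : t * (1 - t ^ 2 / 4) ≤ Real.sin t := by
    have := Real.sin_gt_sub_cube ht0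
    have h3 : 0 < t ^ 3 := pow_pos ht0 3
    linarith
  have hnn : 0 ≤ t * (1 - t ^ 2 / 4) := by
    apply mul_nonneg ht0.le
    nlinarith
  have hsq : (t * (1 - t ^ 2 / 4)) ^ 2 ≤ Real.sin t ^ 2 := pow_le_pow_left₀ hnn hs 2
  calc (1 : ℝ) ≤ (1 - t ^ 2 / 4) ^ 2 * (1 + t ^ 2) := by
        have h1 : t ^ 2 ≤ 1 := by nlinarith
        have h2 : 0 ≤ t ^ 2 := sq_nonneg t
        nlinarith [mul_nonneg h2 (sub_nonneg.2 h1), mul_nonneg h2 (mul_nonneg h2 h2),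
          mul_nonneg h2 h2]
    _ = 4 * (t * (1 - t ^ 2 / 4)) ^ 2 * (1 / (4 * t ^ 2) + 1 / 4) := by
        field_simp
    _ ≤ _ := by gcongr

/-- The discrete Poincaré inequality with Dirichlet boundary conditions, with sharp constant. -/
theorem discrete_dirichlet (P : ℕ) (hP : 1 ≤ P) (S : ℕ → ℝ) (h0 : S 0 = 0) (hSP : S P = 0) :
    (2 - 2 * Real.cos (Real.pi / P)) * ∑ k ∈ range P, S k ^ 2 ≤
      ∑ k ∈ range P, (S (k + 1) - S k) ^ 2 := by
  have hP' : (0 : ℝ) < P := by exact_mod_cast hP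
  have hpi := Real.pi_pos
  let h : ℝ → ℝ := fun t => Real.sin (Real.pi * t / P)
  have hpos : ∀ k : ℕ, 0 < k → k < P → 0 < h k := by
    intro k hk hkP
    have hk' : (0 : ℝ) < k := by exact_mod_cast hk
    have hkP' : (k : ℝ) < P := by exact_mod_cast hkP
    apply Real.sin_pos_of_pos_of_lt_pi
    · positivity
    · rw [div_lt_iff₀ hP']; nlinarith
  have hz : h 0 = 0 := by simp [h]
  have hzP : h P = 0 := by
    simp only [h]
    rw [mul_div_assoc, div_self hP'.ne', mul_one, Real.sin_pi]
  let A : ℕ → ℝ := fun k => S k ^ 2 * (1 - h ((k : ℝ) - 1) / h k)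
  let B : ℕ → ℝ := fun k => S k ^ 2 * (1 - h ((k : ℝ) + 1) / h k)
  have hterm : ∀ k ∈ range P, A (k + 1) + B k ≤ (S (k + 1) - S k) ^ 2 := by
    intro k hk
    have hkP := mem_range.1 hk
    have e1 : A (k + 1) = S (k + 1) ^ 2 * (1 - h k / h ((k + 1 : ℕ) : ℝ)) := by
      simp [A]
    have e2 : B k = S k ^ 2 * (1 - h ((k + 1 : ℕ) : ℝ) / h k) := by
      simp [B]
    rw [e1, e2]
    rcases Nat.eq_zero_or_pos k with rfl | hk0
    · simp [h0, hz]
    rcases Nat.lt_or_ge (k + 1) P with hk1 | hk1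
    · have p1 := hpos k hk0 hkP
      have p2 := hpos (k + 1) (by omega) hk1
      generalize h k = a at *
      generalize h ((k + 1 : ℕ) : ℝ) = b at *
      have : (S (k + 1) - S k) ^ 2 - (S (k + 1) ^ 2 * (1 - a / b) + S k ^ 2 * (1 - b / a)) =
          (S (k + 1) * a - S k * b) ^ 2 / (a * b) := by
        field_simp; ring
      have h3 : 0 ≤ (S (k + 1) * a - S k * b) ^ 2 / (a * b) := by positivity
      linarith
    · have : k + 1 = P := by omega
      rw [this, hSP, hzP]; simp
  have hAB : ∀ k ∈ range P, A k + B k = (2 - 2 * Real.cos (Real.pi / P)) * S k ^ 2 := by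
    intro k hk
    rcases Nat.eq_zero_or_pos k with rfl | hk0
    · simp [A, B, h0]
    have p1 := hpos k hk0 (mem_range.1 hk)
    have key : h ((k : ℝ) - 1) + h ((k : ℝ) + 1) = 2 * Real.cos (Real.pi / P) * h k := by
      simp only [h]
      have e1 : Real.pi * ((k : ℝ) - 1) / P = Real.pi * k / P - Real.pi / P := by ring
      have e2 : Real.pi * ((k : ℝ) + 1) / P = Real.pi * k / P + Real.pi / P := by ring
      rw [e1, e2, Real.sin_add, Real.sin_sub]; ring
    have : A k + B k = S k ^ 2 * (2 - (h ((k : ℝ) - 1) + h ((k : ℝ) + 1)) / h k) := by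
      simp only [A, B]; ring
    rw [this, key]
    field_simp
  have hshift : ∑ k ∈ range P, A (k + 1) = ∑ k ∈ range P, A k := by
    have h1 := Finset.sum_range_succ A P
    have h2 := Finset.sum_range_succ' A P
    have hA0 : A 0 = 0 := by simp [A, h0]
    have hAP : A P = 0 := by simp [A, hSP]
    linarith
  calc _ = ∑ k ∈ range P, (A k + B k) := by
        rw [Finset.mul_sum]; exact (Finset.sum_congr rfl hAB).symm
    _ = ∑ k ∈ range P, (A (k + 1) + B k) := by
        rw [Finset.sum_add_distrib, Finset.sum_add_distrib, hshift]
    _ ≤ _ := Finset.sum_le_sum hterm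

/-- Young's inequality in the form `(a + b)² ≤ (1 + θ) a² + (1 + 1/θ) b²`. -/
theorem add_sq_le_young (θ : ℝ) (hθ : 0 < θ) (a b : ℝ) :
    (a + b) ^ 2 ≤ (1 + θ) * a ^ 2 + (1 + 1 / θ) * b ^ 2 := by
  have : (1 + θ) * a ^ 2 + (1 + 1 / θ) * b ^ 2 - (a + b) ^ 2 = (θ * a - b) ^ 2 / θ := by
    field_simp; ring
  have h2 : 0 ≤ (θ * a - b) ^ 2 / θ := by positivity
  linarith

/-- The discrete Poincaré inequality for mean-zero sequences on a path, where the increments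
in an exceptional set `B` are only controlled in `ℓ¹`. -/
theorem discrete_neumann (P : ℕ) (hP : 2 ≤ P) (F : ℕ → ℝ) (hF : ∑ j ∈ range P, F j = 0)
    (B : Finset ℕ) (hB : B ⊆ range (P - 1)) (θ : ℝ) (hθ : 0 < θ) :
    ∑ j ∈ range P, F j ^ 2 ≤
      (1 + θ) * (((P : ℝ) ^ 2 / Real.pi ^ 2 + 1 / 4) *
        ∑ k ∈ range (P - 1) \ B, (F (k + 1) - F k) ^ 2) +
      (1 + 1 / θ) * (P * (∑ k ∈ B, |F (k + 1) - F k|) ^ 2) := by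
  obtain ⟨m, rfl⟩ : ∃ m, P = m + 1 := ⟨P - 1, by omega⟩
  simp only [Nat.add_sub_cancel] at *
  set S : ℕ → ℝ := fun k => ∑ j ∈ range k, F j with hS
  have hS1 : ∀ k, S (k + 1) - S k = F k := fun k => by simp [hS, Finset.sum_range_succ]
  have hSP : S (m + 1) = 0 := hF
  have hS0 : S 0 = 0 := by simp [hS]
  set N := ∑ j ∈ range (m + 1), F j ^ 2 with hN
  set L := (((m + 1 : ℕ) : ℝ) ^ 2 / Real.pi ^ 2 + 1 / 4) with hL
  set D := ∑ k ∈ range m \ B, (F (k + 1) - F k) ^ 2 with hD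
  set b := ∑ k ∈ B, |F (k + 1) - F k| with hb
  have hN0 : 0 ≤ N := Finset.sum_nonneg fun _ _ => sq_nonneg _
  have hD0 : 0 ≤ D := Finset.sum_nonneg fun _ _ => sq_nonneg _
  have hb0 : 0 ≤ b := Finset.sum_nonneg fun _ _ => abs_nonneg _
  have hL0 : 0 ≤ L := by positivity
  have hSS : ∑ k ∈ range (m + 1), S k ^ 2 ≤ L * N := by
    have h1 := discrete_dirichlet (m + 1) (by omega) S hS0 hSP
    simp only [hS1] at h1
    have h2 := one_le_pathGap_mul (m + 1) hP
    have h3 : 0 ≤ ∑ k ∈ range (m + 1), S k ^ 2 := Finset.sum_nonneg fun _ _ => sq_nonneg _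
    calc ∑ k ∈ range (m + 1), S k ^ 2 ≤
        ((2 - 2 * Real.cos (Real.pi / (m + 1 : ℕ))) * L) * ∑ k ∈ range (m + 1), S k ^ 2 :=
          le_mul_of_one_le_left h3 h2
      _ = L * ((2 - 2 * Real.cos (Real.pi / (m + 1 : ℕ))) * ∑ k ∈ range (m + 1), S k ^ 2) := by
          ring
      _ ≤ L * N := by gcongr
  have hSk : ∀ k ≤ m + 1, |S k| ≤ Real.sqrt (((m + 1 : ℕ) : ℝ) * N) := by
    intro k hk
    apply Real.abs_le_sqrt
    calc S k ^ 2 ≤ (range k).card * ∑ j ∈ range k, F j ^ 2 := sq_sum_le_card_mul_sum_sq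
      _ ≤ ((m + 1 : ℕ) : ℝ) * N := by
        rw [card_range]
        gcongr
        exact Finset.sum_le_sum_of_subset_of_nonneg (range_subset_range.2 hk)
          fun _ _ _ => sq_nonneg _
  have habel : N = -∑ k ∈ range m, S (k + 1) * (F (k + 1) - F k) := by
    have gen : ∀ m, ∑ j ∈ range (m + 1), F j ^ 2 =
        S (m + 1) * F m - ∑ k ∈ range m, S (k + 1) * (F (k + 1) - F k) := by
      intro m
      induction m with
      | zero => simp [hS]; ring
      | succ m ih =>
        rw [Finset.sum_range_succ, ih, Finset.sum_range_succ _ m, ← hS1 (m + 1)]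
        ring
    rw [hN, gen m, hSP]; ring
  have hsplit : N ≤ Real.sqrt (L * N) * Real.sqrt D +
      Real.sqrt (((m + 1 : ℕ) : ℝ) * N) * b := by
    rw [← Finset.sum_sdiff hB] at habel
    have h1 : -∑ k ∈ range m \ B, S (k + 1) * (F (k + 1) - F k) ≤
        Real.sqrt (L * N) * Real.sqrt D := by
      rw [← Real.sqrt_mul (by positivity)]
      apply le_trans (neg_le_abs _)
      apply Real.abs_le_sqrt
      refine (Finset.sum_mul_sq_le_sq_mul_sq _ _ _).trans ?_
      gcongr
      refine le_trans ?_ hSS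
      rw [Finset.sum_range_succ' _ m]
      refine le_trans ?_ (le_add_of_nonneg_right (sq_nonneg _))
      exact Finset.sum_le_sum_of_subset_of_nonneg Finset.sdiff_subset fun _ _ _ => sq_nonneg _
    have h2 : -∑ k ∈ B, S (k + 1) * (F (k + 1) - F k) ≤
        Real.sqrt (((m + 1 : ℕ) : ℝ) * N) * b := by
      rw [hb, Finset.mul_sum, ← Finset.sum_neg_distrib]
      apply Finset.sum_le_sum
      intro k hk
      refine (neg_le_abs _).trans ?_
      rw [abs_mul]
      gcongr
      have := mem_range.1 (hB hk)
      exact hSk _ (by omega)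
    linarith
  have hfin : N ≤ (Real.sqrt (L * D) + Real.sqrt (m + 1 : ℕ) * b) ^ 2 := by
    rcases hN0.eq_or_lt with h | h
    · rw [← h]; positivity
    · have hs : 0 < Real.sqrt N := Real.sqrt_pos.2 h
      have hle : Real.sqrt N ≤ Real.sqrt (L * D) + Real.sqrt (m + 1 : ℕ) * b := by
        rw [Real.sqrt_mul hL0, Real.sqrt_mul (by positivity)] at hsplit
        rw [Real.sqrt_mul hL0]
        have hNN : Real.sqrt N * Real.sqrt N = N := Real.mul_self_sqrt hN0
        have : Real.sqrt N * Real.sqrt N ≤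
            Real.sqrt N * (Real.sqrt L * Real.sqrt D + Real.sqrt (m + 1 : ℕ) * b) := by
          rw [hNN]; linarith
        exact le_of_mul_le_mul_left this hs
      calc N = Real.sqrt N ^ 2 := (Real.sq_sqrt hN0).symm
        _ ≤ _ := by gcongr
  refine hfin.trans ((add_sq_le_young θ hθ _ _).trans (le_of_eq ?_))
  rw [Real.sq_sqrt (by positivity), mul_pow, Real.sq_sqrt (by positivity)]

/-- A mean-zero sequence is bounded by its total variation. -/
theorem sq_le_of_sum_eq_zero (P : ℕ) (F : ℕ → ℝ) (hF : ∑ j ∈ range P, F j = 0)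
    (p : ℕ) (hp : p < P) :
    F p ^ 2 ≤ P * ∑ k ∈ range (P - 1), (F (k + 1) - F k) ^ 2 := by
  set D := ∑ k ∈ range (P - 1), (F (k + 1) - F k) ^ 2 with hD
  have hD0 : 0 ≤ D := Finset.sum_nonneg fun _ _ => sq_nonneg _
  have hlt : ∀ a b, a ≤ b → b < P → |F b - F a| ≤ Real.sqrt (P * D) := by
    intro a b hab hb
    apply Real.abs_le_sqrt
    rw [← Finset.sum_Ico_sub F hab]
    refine sq_sum_le_card_mul_sum_sq.trans ?_
    rw [Nat.card_Ico]
    gcongr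
    · omega
    · apply Finset.sum_le_sum_of_subset_of_nonneg
      · intro k hk
        rw [mem_Ico] at hk
        rw [mem_range]; omega
      · exact fun _ _ _ => sq_nonneg _
  have hall : ∀ q < P, |F p - F q| ≤ Real.sqrt (P * D) := by
    intro q hq
    rcases le_total q p with h | h
    · exact hlt q p h hp
    · rw [abs_sub_comm]; exact hlt p q h hq
  have hP : (0 : ℝ) < P := by exact_mod_cast (by omega : 0 < P)
  have hsum : (P : ℝ) * F p = ∑ q ∈ range P, (F p - F q) := by
    rw [Finset.sum_sub_distrib, hF]; simp
  have h1 : (P : ℝ) * |F p| ≤ P * Real.sqrt (P * D) := by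
    rw [← abs_of_pos hP, ← abs_mul, abs_of_pos hP, hsum]
    refine (Finset.abs_sum_le_sum_abs _ _).trans ?_
    refine (Finset.sum_le_sum fun q hq => hall q (mem_range.1 hq)).trans ?_
    simp
  have h2 := le_of_mul_le_mul_left h1 hP
  rw [← sq_abs]
  calc |F p| ^ 2 ≤ Real.sqrt (P * D) ^ 2 := by gcongr
    _ = _ := Real.sq_sqrt (by positivity)

/-- The vertices of `V` are arranged in layers `ℓ = 0, …, D`, as by the distance to a root:
edges join equal or consecutive layers, and every vertex outside the root has a neighbour in
the previous layer. -/
structure IsLayering {V : Type*} (G : SimpleGraph V) (ℓ : V → ℕ) (D : ℕ) : Prop where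
  adj_le : ∀ u v, G.Adj u v → ℓ v ≤ ℓ u + 1
  descend : ∀ u, 0 < ℓ u → ∃ v, G.Adj u v ∧ ℓ v + 1 = ℓ u
  root : ∀ u v, ℓ u = 0 → ℓ v = 0 → u = v
  le : ∀ u, ℓ u ≤ D
  top : ∃ u, ℓ u = D

/-- The `i`-th layer. -/
def layer {V : Type*} [Fintype V] (ℓ : V → ℕ) (i : ℕ) : Finset V := univ.filter fun u => ℓ u = i

/-- The number of vertices in the three consecutive layers starting with the `j`-th one. -/
def tripleCard {V : Type*} [Fintype V] (ℓ : V → ℕ) (j : ℕ) : ℕ :=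
  (layer ℓ j).card + (layer ℓ (j + 1)).card + (layer ℓ (j + 2)).card

open Classical in
/-- The energy of the ordered pair `(u, v)`. -/
noncomputable def pairEnergy {V : Type*} (G : SimpleGraph V) (x : V → ℝ) (u v : V) : ℝ :=
  if G.Adj u v then (x u - x v) ^ 2 else 0

/-- The energy of the edges from the `i`-th layer to the next one. -/
noncomputable def layerEnergy {V : Type*} [Fintype V] (G : SimpleGraph V) (ℓ : V → ℕ)
    (x : V → ℝ) (i : ℕ) : ℝ :=
  ∑ u ∈ layer ℓ i, ∑ v ∈ layer ℓ (i + 1), pairEnergy G x u v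

/-- The average of `x` over the `i`-th layer. -/
noncomputable def layerAvg {V : Type*} [Fintype V] (ℓ : V → ℕ) (x : V → ℝ) (i : ℕ) : ℝ :=
  (∑ u ∈ layer ℓ i, x u) / (layer ℓ i).card

theorem mem_layer {V : Type*} [Fintype V] {ℓ : V → ℕ} {i : ℕ} {u : V} :
    u ∈ layer ℓ i ↔ ℓ u = i := by
  simp [layer]

theorem lapQ_eq {V : Type*} [Fintype V] (G : SimpleGraph V) (x : V → ℝ) :
    lapQ G x = (∑ u, ∑ v, pairEnergy G x u v) / 2 := by
  classical
  have := @SimpleGraph.lapMatrix_toLinearMap₂' V ℝ _ G (Classical.decRel _) (Classical.decEq V) _ _ x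
  rw [Matrix.toLinearMap₂'_apply'] at this
  unfold lapQ pairEnergy
  convert this

theorem pairEnergy_nonneg {V : Type*} (G : SimpleGraph V) (x : V → ℝ) (u v : V) :
    0 ≤ pairEnergy G x u v := by
  unfold pairEnergy; split_ifs <;> positivity

theorem pairEnergy_comm {V : Type*} (G : SimpleGraph V) (x : V → ℝ) (u v : V) :
    pairEnergy G x u v = pairEnergy G x v u := by
  unfold pairEnergy
  rw [G.adj_comm, ← neg_sub, neg_sq]

theorem lapQ_nonneg {V : Type*} [Fintype V] (G : SimpleGraph V) (x : V → ℝ) : 0 ≤ lapQ G x := by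
  rw [lapQ_eq]
  have : 0 ≤ ∑ u, ∑ v, pairEnergy G x u v :=
    Finset.sum_nonneg fun _ _ => Finset.sum_nonneg fun _ _ => pairEnergy_nonneg _ _ _ _
  positivity

theorem abs_sub_le_of_adj {V : Type*} [Fintype V] (G : SimpleGraph V) (x : V → ℝ) {u v : V}
    (h : G.Adj u v) : |x u - x v| ≤ Real.sqrt (2 * lapQ G x) := by
  apply Real.abs_le_sqrt
  rw [lapQ_eq]
  have h1 : (x u - x v) ^ 2 = pairEnergy G x u v := by simp [pairEnergy, h]
  rw [h1, mul_div_cancel₀ _ two_ne_zero]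
  calc _ ≤ ∑ v, pairEnergy G x u v :=
        Finset.single_le_sum (f := fun v => pairEnergy G x u v)
          (fun _ _ => pairEnergy_nonneg _ _ _ _) (mem_univ v)
    _ ≤ _ := Finset.single_le_sum (f := fun u => ∑ v, pairEnergy G x u v)
          (fun _ _ => Finset.sum_nonneg fun _ _ => pairEnergy_nonneg _ _ _ _) (mem_univ u)

theorem sum_card_layer_le {V : Type*} [Fintype V] (ℓ : V → ℕ) (m k : ℕ) :
    ∑ j ∈ range m, (layer ℓ (j + k)).card ≤ Fintype.card V := by
  classical
  rw [← Finset.card_biUnion]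
  · exact Finset.card_le_univ _
  · intro i _ j _ hij
    rw [Function.onFun, Finset.disjoint_left]
    intro u hu hv
    rw [mem_layer] at hu hv
    omega

theorem sum_layerEnergy_le {V : Type*} [Fintype V] (G : SimpleGraph V) (ℓ : V → ℕ)
    (x : V → ℝ) (m : ℕ) : ∑ i ∈ range m, layerEnergy G ℓ x i ≤ lapQ G x := by
  classical
  have h1 : ∀ i, layerEnergy G ℓ x i =
      ∑ u, ∑ v, if ℓ u = i ∧ ℓ v = i + 1 then pairEnergy G x u v else 0 := by
    intro i
    unfold layerEnergy layer
    rw [Finset.sum_filter]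
    refine Finset.sum_congr rfl fun u _ => ?_
    split_ifs with h
    · simp [h, Finset.sum_filter]
    · simp [h]
  have h2 : ∑ i ∈ range m, layerEnergy G ℓ x i ≤
      ∑ u, ∑ v, if ℓ v = ℓ u + 1 then pairEnergy G x u v else 0 := by
    simp only [h1]
    rw [Finset.sum_comm]
    refine Finset.sum_le_sum fun u _ => ?_
    rw [Finset.sum_comm]
    refine Finset.sum_le_sum fun v _ => ?_
    have hn := pairEnergy_nonneg G x u v
    by_cases hv : ℓ v = ℓ u + 1
    · rw [if_pos hv]
      calc _ ≤ ∑ i ∈ range m, if ℓ u = i then pairEnergy G x u v else 0 := by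
            refine Finset.sum_le_sum fun i _ => ?_
            split_ifs <;> first | rfl | exact hn | (exfalso; tauto)
        _ ≤ _ := by
            rw [Finset.sum_ite_eq]
            split_ifs <;> first | rfl | exact hn
    · rw [if_neg hv]
      refine le_of_eq (Finset.sum_eq_zero fun i _ => ?_)
      rw [if_neg]; omega
  have h3 : (∑ u, ∑ v, if ℓ v = ℓ u + 1 then pairEnergy G x u v else 0) =
      ∑ u, ∑ v, if ℓ u = ℓ v + 1 then pairEnergy G x u v else 0 := by
    rw [Finset.sum_comm]
    refine Finset.sum_congr rfl fun u _ => Finset.sum_congr rfl fun v _ => ?_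
    rw [pairEnergy_comm]
  have h4 : (∑ u, ∑ v, if ℓ v = ℓ u + 1 then pairEnergy G x u v else 0) +
      (∑ u, ∑ v, if ℓ u = ℓ v + 1 then pairEnergy G x u v else 0) ≤
      ∑ u, ∑ v, pairEnergy G x u v := by
    simp only [← Finset.sum_add_distrib]
    refine Finset.sum_le_sum fun u _ => Finset.sum_le_sum fun v _ => ?_
    have hn := pairEnergy_nonneg G x u v
    split_ifs <;> first | omega | linarith
  rw [lapQ_eq]
  linarith

/-- The energy between two completely joined sets dominates that of the averages. -/
theorem sq_avg_sub_avg_le {V : Type*} (A B : Finset V) (hA : A.Nonempty) (hB : B.Nonempty)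
    (x : V → ℝ) :
    ((∑ v ∈ B, x v) / B.card - (∑ u ∈ A, x u) / A.card) ^ 2 ≤
      1 / (A.card * B.card) * ∑ u ∈ A, ∑ v ∈ B, (x u - x v) ^ 2 := by
  have hA' : (0 : ℝ) < A.card := by exact_mod_cast hA.card_pos
  have hB' : (0 : ℝ) < B.card := by exact_mod_cast hB.card_pos
  have h1 := sq_sum_le_card_mul_sum_sq (s := A ×ˢ B) (f := fun p : V × V => x p.1 - x p.2)
  rw [Finset.sum_product, Finset.sum_product, Finset.card_product] at h1
  have h2 : ∑ u ∈ A, ∑ v ∈ B, (x u - x v) =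
      -((A.card * B.card : ℝ) * ((∑ v ∈ B, x v) / B.card - (∑ u ∈ A, x u) / A.card)) := by
    simp only [Finset.sum_sub_distrib, Finset.sum_const, nsmul_eq_mul, ← Finset.mul_sum]
    field_simp; ring
  simp only at h1
  rw [h2, neg_sq, mul_pow] at h1
  rw [one_div, inv_mul_eq_div, le_div_iff₀ (by positivity)]
  push_cast at h1
  have h3 : (0 : ℝ) < A.card * B.card := by positivity
  refine le_of_mul_le_mul_left ?_ h3
  linarith

namespace IsLayering

variable {V : Type*} {G : SimpleGraph V} {ℓ : V → ℕ} {D : ℕ}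

theorem exists_eq (h : IsLayering G ℓ D) {i : ℕ} (hi : i ≤ D) : ∃ u, ℓ u = i := by
  induction hi using Nat.decreasingInduction with
  | self => exact h.top
  | of_succ k _ ih =>
    obtain ⟨u, hu⟩ := ih
    obtain ⟨v, -, hv⟩ := h.descend u (by omega)
    exact ⟨v, by omega⟩

variable [Fintype V]

theorem layer_nonempty (h : IsLayering G ℓ D) {i : ℕ} (hi : i ≤ D) : (layer ℓ i).Nonempty := by
  obtain ⟨u, hu⟩ := h.exists_eq hi
  exact ⟨u, mem_layer.2 hu⟩

theorem tripleCard_eq (ℓ : V → ℕ) (j : ℕ) :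
    tripleCard ℓ j = (univ.filter fun w => j ≤ ℓ w ∧ ℓ w ≤ j + 2).card := by
  classical
  unfold tripleCard
  rw [← Finset.card_union_of_disjoint, ← Finset.card_union_of_disjoint]
  · congr 1
    ext w
    simp only [mem_union, mem_layer, mem_filter, mem_univ, true_and]
    omega
  · rw [Finset.disjoint_left]
    intro w
    simp only [mem_union, mem_layer]
    omega
  · rw [Finset.disjoint_left]
    intro w
    simp only [mem_layer]
    omega

theorem insert_neighborSet_subset (h : IsLayering G ℓ D) {u : V} {j : ℕ} (hu : ℓ u = j + 1) :
    insert u (G.neighborSet u) ⊆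
      ((univ.filter fun w => j ≤ ℓ w ∧ ℓ w ≤ j + 2 : Finset V) : Set V) := by
  intro w hw
  rcases hw with rfl | hw
  · simp; omega
  · have h1 := h.adj_le _ _ hw
    have h2 := h.adj_le _ _ hw.symm
    simp; omega

theorem ncard_insert (G : SimpleGraph V) (u : V) :
    (insert u (G.neighborSet u)).ncard = (G.neighborSet u).ncard + 1 :=
  Set.ncard_insert_of_notMem (by simp) (Set.toFinite _)

theorem le_tripleCard (h : IsLayering G ℓ D) {d : ℕ} (hd : ∀ v, d ≤ (G.neighborSet v).ncard)
    {j : ℕ} (hj : j + 1 ≤ D) : d + 1 ≤ tripleCard ℓ j := by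
  obtain ⟨u, hu⟩ := h.exists_eq hj
  rw [tripleCard_eq, ← Set.ncard_coe_finset]
  calc d + 1 ≤ (insert u (G.neighborSet u)).ncard := by
        rw [ncard_insert]; exact Nat.add_le_add_right (hd u) 1
    _ ≤ _ := Set.ncard_le_ncard (h.insert_neighborSet_subset hu) (Set.toFinite _)

/-- If three consecutive layers have the least possible size, then the vertices of the middle
one are adjacent to all other vertices in these layers. -/
theorem adj_of_tripleCard_eq (h : IsLayering G ℓ D) {d : ℕ}
    (hd : ∀ v, d ≤ (G.neighborSet v).ncard) {j : ℕ} (hj : tripleCard ℓ j = d + 1) {u w : V}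
    (hu : ℓ u = j + 1) (hw : j ≤ ℓ w) (hw' : ℓ w ≤ j + 2) (hne : w ≠ u) : G.Adj u w := by
  rw [tripleCard_eq, ← Set.ncard_coe_finset] at hj
  have heq := Set.eq_of_subset_of_ncard_le (h.insert_neighborSet_subset hu)
    (by rw [hj, ncard_insert]; exact Nat.add_le_add_right (hd u) 1) (Set.toFinite _)
  have hmem : w ∈ insert u (G.neighborSet u) := by
    rw [heq]; simp; omega
  rcases hmem with heq | hadj
  · exact absurd heq hne
  · exact hadj

/-- The indices of triples of layers which are larger than necessary. -/
def bad (ℓ : V → ℕ) (D d : ℕ) : Finset ℕ := (range (D - 1)).filter fun j => tripleCard ℓ j ≠ d + 1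

theorem card_bad_le (h : IsLayering G ℓ D) {d C : ℕ} (hd : ∀ v, d ≤ (G.neighborSet v).ncard)
    (hD : 1 ≤ D) (hC : 3 * Fintype.card V + (d + 1) ≤ D * (d + 1) + C) :
    (bad ℓ D d).card ≤ C := by
  have h1 : ∑ j ∈ range (D - 1), tripleCard ℓ j ≤ 3 * Fintype.card V := by
    unfold tripleCard
    rw [Finset.sum_add_distrib, Finset.sum_add_distrib]
    have h0 := sum_card_layer_le ℓ (D - 1) 0
    have h1 := sum_card_layer_le ℓ (D - 1) 1
    have h2 := sum_card_layer_le ℓ (D - 1) 2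
    simp only [add_zero] at h0
    omega
  have h2 : ∑ j ∈ range (D - 1), ((d + 1) + if tripleCard ℓ j ≠ d + 1 then 1 else 0) ≤
      ∑ j ∈ range (D - 1), tripleCard ℓ j := by
    refine Finset.sum_le_sum fun j hj => ?_
    have := h.le_tripleCard hd (j := j) (by have := mem_range.1 hj; omega)
    split_ifs <;> omega
  rw [Finset.sum_add_distrib, ← Finset.card_filter, Finset.sum_const, card_range,
    smul_eq_mul] at h2
  obtain ⟨m, rfl⟩ : ∃ m, D = m + 1 := ⟨D - 1, by omega⟩
  simp only [Nat.add_sub_cancel] at *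
  unfold bad
  simp only [Nat.add_sub_cancel]
  nlinarith

theorem exists_ancestor (h : IsLayering G ℓ D) (x : V → ℝ) (u : V) (k : ℕ) (hk : k ≤ ℓ u) :
    ∃ w, ℓ w + k = ℓ u ∧ |x u - x w| ≤ k * Real.sqrt (2 * lapQ G x) := by
  induction k with
  | zero => exact ⟨u, by simp⟩
  | succ k ih =>
    obtain ⟨w, hw, hx⟩ := ih (by omega)
    obtain ⟨v, hv, hv'⟩ := h.descend w (by omega)
    refine ⟨v, by omega, ?_⟩
    have h1 := abs_sub_le_of_adj G x hv
    have h2 := abs_sub_le (x u) (x w) (x v)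
    push_cast
    linarith

/-- Vertices in nearby layers have nearby values. -/
theorem abs_sub_le (h : IsLayering G ℓ D) {d C : ℕ} (hd : ∀ v, d ≤ (G.neighborSet v).ncard)
    (hD : 1 ≤ D) (hC : 3 * Fintype.card V + (d + 1) ≤ D * (d + 1) + C) (x : V → ℝ)
    (u v : V) (huv : ℓ u ≤ ℓ v) (huv' : ℓ v ≤ ℓ u + 4) :
    |x u - x v| ≤ (2 * C + 10 : ℝ) * Real.sqrt (2 * lapQ G x) := by
  have hs := Real.sqrt_nonneg (2 * lapQ G x)
  obtain ⟨t, ht, htC, hclose⟩ : ∃ t ≤ ℓ u, ℓ u ≤ t + C + 2 ∧ ∀ a b, ℓ a = t → ℓ b = t →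
      |x a - x b| ≤ Real.sqrt (2 * lapQ G x) := by
    by_cases hu : ℓ u ≤ C + 2
    · refine ⟨0, by omega, by omega, fun a b ha hb => ?_⟩
      rw [h.root a b ha hb]; simp
    · obtain ⟨j, hj, hjb⟩ : ∃ j ∈ Icc (ℓ u - 2 - C) (ℓ u - 2), j ∉ bad ℓ D d := by
        by_contra! hcon
        have h1 := Finset.card_le_card (show Icc (ℓ u - 2 - C) (ℓ u - 2) ⊆ bad ℓ D d from hcon)
        rw [Nat.card_Icc] at h1
        have h2 := h.card_bad_le hd hD hC
        omega
      rw [mem_Icc] at hj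
      have hle := h.le u
      have hT : tripleCard ℓ j = d + 1 := by
        by_contra hne
        exact hjb (mem_filter.2 ⟨mem_range.2 (by omega), hne⟩)
      refine ⟨j + 1, by omega, by omega, fun a b ha hb => ?_⟩
      by_cases hab : b = a
      · rw [hab]; simp
      · exact abs_sub_le_of_adj G x
          (h.adj_of_tripleCard_eq hd hT ha (by omega) (by omega) hab)
  obtain ⟨a, ha, hxa⟩ := h.exists_ancestor x u (ℓ u - t) (by omega)
  obtain ⟨b, hb, hxb⟩ := h.exists_ancestor x v (ℓ v - t) (by omega)
  have hab := hclose a b (by omega) (by omega)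
  have h1 : |x u - x v| ≤ |x u - x a| + |x a - x b| + |x v - x b| := by
    rw [abs_sub_comm (x v)]
    linarith [_root_.abs_sub_le (x u) (x a) (x v), _root_.abs_sub_le (x a) (x b) (x v)]
  have h2 : ((ℓ u - t : ℕ) : ℝ) ≤ C + 2 := by
    exact_mod_cast (by omega : ℓ u - t ≤ C + 2)
  have h3 : ((ℓ v - t : ℕ) : ℝ) ≤ C + 6 := by
    exact_mod_cast (by omega : ℓ v - t ≤ C + 6)
  have h4 := mul_le_mul_of_nonneg_right h2 hs
  have h5 := mul_le_mul_of_nonneg_right h3 hs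
  linarith

/-- A layer average is close to the values in nearby layers. -/
theorem abs_layerAvg_sub_le (h : IsLayering G ℓ D) {d C : ℕ}
    (hd : ∀ v, d ≤ (G.neighborSet v).ncard)
    (hD : 1 ≤ D) (hC : 3 * Fintype.card V + (d + 1) ≤ D * (d + 1) + C) (x : V → ℝ)
    (v : V) (i : ℕ) (hi : i ≤ ℓ v) (hi' : ℓ v ≤ i + 4) :
    |layerAvg ℓ x i - x v| ≤ (2 * C + 10 : ℝ) * Real.sqrt (2 * lapQ G x) := by
  have hne := h.layer_nonempty (hi.trans (h.le v))
  have hc : (0 : ℝ) < (layer ℓ i).card := by exact_mod_cast hne.card_pos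
  have h1 : layerAvg ℓ x i - x v = (∑ u ∈ layer ℓ i, (x u - x v)) / (layer ℓ i).card := by
    unfold layerAvg
    rw [Finset.sum_sub_distrib, Finset.sum_const, nsmul_eq_mul]
    field_simp
  rw [h1, abs_div, abs_of_pos hc, div_le_iff₀ hc]
  refine (Finset.abs_sum_le_sum_abs _ _).trans ?_
  refine (Finset.sum_le_sum (g := fun _ => (2 * C + 10 : ℝ) * Real.sqrt (2 * lapQ G x)) ?_).trans ?_
  · intro u hu
    have := mem_layer.1 hu
    exact h.abs_sub_le hd hD hC x u v (by omega) (by omega)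
  · rw [Finset.sum_const, nsmul_eq_mul, mul_comm]

theorem abs_layerAvg_sub_layerAvg_le (h : IsLayering G ℓ D) {d C : ℕ}
    (hd : ∀ v, d ≤ (G.neighborSet v).ncard)
    (hD : 1 ≤ D) (hC : 3 * Fintype.card V + (d + 1) ≤ D * (d + 1) + C) (x : V → ℝ)
    (i k : ℕ) (hi : i ≤ k) (hk : k ≤ i + 4) (hkD : k ≤ D) :
    |layerAvg ℓ x k - layerAvg ℓ x i| ≤ (2 * C + 10 : ℝ) * Real.sqrt (2 * lapQ G x) := by
  have hne := h.layer_nonempty hkD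
  have hc : (0 : ℝ) < (layer ℓ k).card := by exact_mod_cast hne.card_pos
  have h1 : layerAvg ℓ x k - layerAvg ℓ x i =
      (∑ u ∈ layer ℓ k, (x u - layerAvg ℓ x i)) / (layer ℓ k).card := by
    rw [Finset.sum_sub_distrib, Finset.sum_const, nsmul_eq_mul, sub_div,
      mul_div_cancel_left₀ _ hc.ne']
    rfl
  rw [h1, abs_div, abs_of_pos hc, div_le_iff₀ hc]
  refine (Finset.abs_sum_le_sum_abs _ _).trans ?_
  refine (Finset.sum_le_sum (g := fun _ => (2 * C + 10 : ℝ) * Real.sqrt (2 * lapQ G x)) ?_).trans ?_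
  · intro u hu
    have := mem_layer.1 hu
    rw [abs_sub_comm]
    exact h.abs_layerAvg_sub_le hd hD hC x u i (by omega) (by omega)
  · rw [Finset.sum_const, nsmul_eq_mul, mul_comm]

theorem sq_layerAvg_succ_le (h : IsLayering G ℓ D) (x : V → ℝ) (i : ℕ) (hi : i + 1 ≤ D)
    (hadj : ∀ u ∈ layer ℓ i, ∀ v ∈ layer ℓ (i + 1), G.Adj u v) :
    (layerAvg ℓ x (i + 1) - layerAvg ℓ x i) ^ 2 ≤
      1 / ((layer ℓ i).card * (layer ℓ (i + 1)).card) * layerEnergy G ℓ x i := by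
  have := sq_avg_sub_avg_le _ _ (h.layer_nonempty (by omega : i ≤ D)) (h.layer_nonempty hi) x
  refine this.trans (le_of_eq ?_)
  congr 1
  refine Finset.sum_congr rfl fun u hu => Finset.sum_congr rfl fun v hv => ?_
  simp [pairEnergy, hadj u hu v hv]

theorem series_resistance (d a b e p q r X Y Z : ℝ) (hd : 1 < d) (ha : 1 ≤ a) (hb : 1 ≤ b)
    (he : 1 ≤ e) (hsum : a + b + e = d + 1)
    (hp : p ^ 2 ≤ 1 / (a * b) * X) (hq : q ^ 2 ≤ 1 / (b * e) * Y) (hr : r ^ 2 ≤ 1 / (e * a) * Z) :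
    (p + q + r) ^ 2 ≤ (d + 1) / (d - 1) * (X + Y + Z) := by
  have ha0 : 0 < a := by linarith
  have hb0 : 0 < b := by linarith
  have he0 : 0 < e := by linarith
  rw [one_div, inv_mul_eq_div, le_div_iff₀ (by positivity)] at hp hq hr
  have hprod : d - 1 ≤ a * b * e := by
    have h1 : a + b - 1 ≤ a * b := by nlinarith
    nlinarith
  have h2 : (p + q + r) ^ 2 * (a * b * e) ≤
      (a + b + e) * (p ^ 2 * (a * b) + q ^ 2 * (b * e) + r ^ 2 * (e * a)) := by
    have key : (a + b + e) * (p ^ 2 * (a * b) + q ^ 2 * (b * e) + r ^ 2 * (e * a)) -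
        (p + q + r) ^ 2 * (a * b * e) =
        b * (a * p - e * q) ^ 2 + a * (b * p - e * r) ^ 2 + e * (b * q - a * r) ^ 2 := by ring
    have : 0 ≤ b * (a * p - e * q) ^ 2 + a * (b * p - e * r) ^ 2 + e * (b * q - a * r) ^ 2 := by
      positivity
    linarith
  rw [div_mul_eq_mul_div, le_div_iff₀ (by linarith)]
  calc (p + q + r) ^ 2 * (d - 1) ≤ (p + q + r) ^ 2 * (a * b * e) := by gcongr
    _ ≤ _ := h2
    _ ≤ _ := by rw [hsum]; gcongr

/-- Across a full period of minimal layers, the averages are controlled by the energy with the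
optimal constant. -/
theorem sq_layerAvg_period_le (h : IsLayering G ℓ D) {d : ℕ} (hd1 : 1 < d)
    (hd : ∀ v, d ≤ (G.neighborSet v).ncard) (x : V → ℝ) (i : ℕ) (hi : i + 3 ≤ D)
    (h1 : tripleCard ℓ i = d + 1) (h2 : tripleCard ℓ (i + 1) = d + 1) :
    (layerAvg ℓ x (i + 3) - layerAvg ℓ x i) ^ 2 ≤ ((d : ℝ) + 1) / (d - 1) *
      (layerEnergy G ℓ x i + layerEnergy G ℓ x (i + 1) + layerEnergy G ℓ x (i + 2)) := by
  have e0 := h.sq_layerAvg_succ_le x i (by omega) (by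
    intro u hu v hv
    rw [mem_layer] at hu hv
    exact (h.adj_of_tripleCard_eq hd h1 hv (by omega) (by omega) (by rintro rfl; omega)).symm)
  have e1 := h.sq_layerAvg_succ_le x (i + 1) (by omega) (by
    intro u hu v hv
    rw [mem_layer] at hu hv
    exact h.adj_of_tripleCard_eq hd h1 hu (by omega) (by omega) (by rintro rfl; omega))
  have e2 := h.sq_layerAvg_succ_le x (i + 2) (by omega) (by
    intro u hu v hv
    rw [mem_layer] at hu hv
    exact h.adj_of_tripleCard_eq hd h2 hu (by omega) (by omega) (by rintro rfl; omega))
  have hcard : (layer ℓ (i + 2 + 1)).card = (layer ℓ i).card := by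
    unfold tripleCard at h1 h2
    have : i + 1 + 2 = i + 2 + 1 := by ring
    rw [this] at h2
    have : i + 1 + 1 = i + 2 := by ring
    rw [this] at h2
    omega
  have one_le : ∀ k ≤ D, (1 : ℝ) ≤ (layer ℓ k).card := fun k hk => by
    exact_mod_cast (h.layer_nonempty hk).card_pos
  rw [hcard] at e2
  have := series_resistance d _ _ _ _ _ _ _ _ _ (by exact_mod_cast hd1)
    (one_le i (by omega)) (one_le (i + 1) (by omega)) (one_le (i + 2) (by omega))
    (by exact_mod_cast h1) e0 e1 e2
  refine le_trans (le_of_eq ?_) this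
  ring_nf

/-- The indices `k` for which one of the triples starting at the layers `3 * k` and
`3 * k + 1` is larger than necessary. -/
def badBlock (ℓ : V → ℕ) (D d m : ℕ) : Finset ℕ :=
  (range m).filter fun k => 3 * k ∈ bad ℓ D d ∨ 3 * k + 1 ∈ bad ℓ D d

theorem card_badBlock_le (ℓ : V → ℕ) (D d m : ℕ) :
    (badBlock ℓ D d m).card ≤ (bad ℓ D d).card := by
  apply Finset.card_le_card_of_injOn (fun k => if 3 * k ∈ bad ℓ D d then 3 * k else 3 * k + 1)
  · intro k hk
    have := (mem_filter.1 (mem_coe.1 hk)).2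
    simp only [mem_coe]
    split_ifs with h1
    · exact h1
    · tauto
  · intro k _ k' _ hkk
    simp only at hkk
    split_ifs at hkk <;> omega

theorem sum_range_three_mul (e : ℕ → ℝ) (m : ℕ) :
    ∑ k ∈ range m, (e (3 * k) + e (3 * k + 1) + e (3 * k + 2)) = ∑ i ∈ range (3 * m), e i := by
  induction m with
  | zero => simp
  | succ m ih =>
    rw [Finset.sum_range_succ, ih, show 3 * (m + 1) = 3 * m + 1 + 1 + 1 by ring,
      Finset.sum_range_succ, Finset.sum_range_succ, Finset.sum_range_succ]
    ring

/-- The energy bounds the squared increments of the block averages outside bad blocks. -/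
theorem sum_sq_good_le (h : IsLayering G ℓ D) {d : ℕ} (hd1 : 1 < d)
    (hd : ∀ v, d ≤ (G.neighborSet v).ncard) (x : V → ℝ) (m : ℕ) (hm : 3 * m + 2 ≤ D) :
    ∑ k ∈ range m \ badBlock ℓ D d m,
      (layerAvg ℓ x (3 * (k + 1)) - layerAvg ℓ x (3 * k)) ^ 2 ≤
      ((d : ℝ) + 1) / (d - 1) * lapQ G x := by
  have hd1' : (1 : ℝ) < d := by exact_mod_cast hd1
  have hR : 0 ≤ ((d : ℝ) + 1) / (d - 1) := div_nonneg (by linarith) (by linarith)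
  have hen : ∀ i, 0 ≤ layerEnergy G ℓ x i := fun i =>
    Finset.sum_nonneg fun _ _ => Finset.sum_nonneg fun _ _ => pairEnergy_nonneg _ _ _ _
  have hbad : ∀ j, j < D - 1 → j ∉ bad ℓ D d → tripleCard ℓ j = d + 1 := by
    intro j hj hjb
    by_contra hne
    exact hjb (mem_filter.2 ⟨mem_range.2 hj, hne⟩)
  calc _ ≤ ∑ k ∈ range m \ badBlock ℓ D d m, ((d : ℝ) + 1) / (d - 1) *
        (layerEnergy G ℓ x (3 * k) + layerEnergy G ℓ x (3 * k + 1) +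
          layerEnergy G ℓ x (3 * k + 2)) := by
        refine Finset.sum_le_sum fun k hk => ?_
        rw [Finset.mem_sdiff, badBlock, mem_filter] at hk
        have hkm := mem_range.1 hk.1
        have hk2 : 3 * k ∉ bad ℓ D d ∧ 3 * k + 1 ∉ bad ℓ D d := by tauto
        exact h.sq_layerAvg_period_le hd1 hd x (3 * k) (by omega)
          (hbad _ (by omega) hk2.1) (hbad _ (by omega) hk2.2)
    _ ≤ ∑ k ∈ range m, ((d : ℝ) + 1) / (d - 1) *
        (layerEnergy G ℓ x (3 * k) + layerEnergy G ℓ x (3 * k + 1) +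
          layerEnergy G ℓ x (3 * k + 2)) := by
        refine Finset.sum_le_sum_of_subset_of_nonneg Finset.sdiff_subset fun k _ _ => ?_
        exact mul_nonneg hR (add_nonneg (add_nonneg (hen _) (hen _)) (hen _))
    _ = ((d : ℝ) + 1) / (d - 1) * ∑ i ∈ range (3 * m), layerEnergy G ℓ x i := by
        rw [← Finset.mul_sum, sum_range_three_mul]
    _ ≤ _ := by
        gcongr
        exact sum_layerEnergy_le G ℓ x _

/-- The block of a vertex; the last block also contains the remaining layers. -/
def block (ℓ : V → ℕ) (P : ℕ) (u : V) : ℕ := min (ℓ u / 3) (P - 1)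

theorem le_card_block (h : IsLayering G ℓ D) {d : ℕ} (hd : ∀ v, d ≤ (G.neighborSet v).ncard)
    {P p : ℕ} (hP : 3 * P ≤ D + 1) (hp : p < P) :
    d + 1 ≤ (univ.filter fun u => block ℓ P u = p).card := by
  refine (h.le_tripleCard hd (j := 3 * p) (by omega)).trans ?_
  rw [tripleCard_eq]
  refine Finset.card_le_card fun w hw => ?_
  have hw' := (mem_filter.1 hw).2
  refine mem_filter.2 ⟨mem_univ _, ?_⟩
  unfold block
  omega

/-- Block functions: comparing the sum over vertices with the sum over blocks. -/
theorem sum_block_le (h : IsLayering G ℓ D) {d C : ℕ}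
    (hd : ∀ v, d ≤ (G.neighborSet v).ncard)
    (hC : 3 * Fintype.card V + (d + 1) ≤ D * (d + 1) + C) {P : ℕ} (hP0 : 1 ≤ P)
    (hP : 3 * P ≤ D + 1) (hP' : D ≤ 3 * P + 1) (g : ℕ → ℝ) (M : ℝ) (hM : 0 ≤ M)
    (hg : ∀ p < P, g p ≤ M) :
    P * (d + 1) ≤ Fintype.card V ∧
    ∑ u, g (block ℓ P u) ≤ (d + 1) * ∑ p ∈ range P, g p + C * M := by
  classical
  have hmaps : ∀ u ∈ (univ : Finset V), block ℓ P u ∈ range P := fun u _ => by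
    rw [mem_range, block]; omega
  have hcard : Fintype.card V = ∑ p ∈ range P, (univ.filter fun u => block ℓ P u = p).card := by
    rw [← Finset.card_univ]
    exact Finset.card_eq_sum_card_fiberwise hmaps
  have hlow : P * (d + 1) ≤ Fintype.card V := by
    rw [hcard]
    calc P * (d + 1) = ∑ p ∈ range P, (d + 1) := by simp
      _ ≤ _ := Finset.sum_le_sum fun p hp => h.le_card_block hd hP (mem_range.1 hp)
  refine ⟨hlow, ?_⟩
  have hsum : ∑ u, g (block ℓ P u) =
      ∑ p ∈ range P, ((univ.filter fun u => block ℓ P u = p).card : ℝ) * g p := by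
    rw [← Finset.sum_fiberwise_of_maps_to hmaps]
    refine Finset.sum_congr rfl fun p _ => ?_
    rw [← nsmul_eq_mul, ← Finset.sum_const]
    refine Finset.sum_congr rfl fun u hu => ?_
    rw [(mem_filter.1 hu).2]
  have hexcess : (Fintype.card V : ℝ) - P * (d + 1) ≤ C := by
    have : Fintype.card V ≤ P * (d + 1) + C := by nlinarith
    have : (Fintype.card V : ℝ) ≤ P * (d + 1) + C := by exact_mod_cast this
    linarith
  have hcardR : (Fintype.card V : ℝ) =
      ∑ p ∈ range P, ((univ.filter fun u => block ℓ P u = p).card : ℝ) := by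
    exact_mod_cast hcard
  rw [hsum]
  calc _ ≤ ∑ p ∈ range P, (((d : ℝ) + 1) * g p +
        (((univ.filter fun u => block ℓ P u = p).card : ℝ) - (d + 1)) * M) := by
        refine Finset.sum_le_sum fun p hp => ?_
        have h1 : ((d : ℝ) + 1) ≤ (univ.filter fun u => block ℓ P u = p).card := by
          exact_mod_cast h.le_card_block hd hP (mem_range.1 hp)
        have h2 := mul_le_mul_of_nonneg_left (hg p (mem_range.1 hp)) (sub_nonneg.2 h1)
        linarith
    _ = ((d : ℝ) + 1) * ∑ p ∈ range P, g p + ((Fintype.card V : ℝ) - P * (d + 1)) * M := by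
        rw [Finset.sum_add_distrib, ← Finset.mul_sum, ← Finset.sum_mul, Finset.sum_sub_distrib,
          ← hcardR, Finset.sum_const, card_range, nsmul_eq_mul]
    _ ≤ _ := by gcongr

/-- The Poincaré inequality on a layered graph with almost minimal layers, with a sharp main
term. -/
theorem sum_sq_le (h : IsLayering G ℓ D) {d C : ℕ} (hd1 : 1 < d)
    (hd : ∀ v, d ≤ (G.neighborSet v).ncard) (hD : 5 ≤ D)
    (hC : 3 * Fintype.card V + (d + 1) ≤ D * (d + 1) + C) (θ : ℝ) (hθ : 0 < θ) (x : V → ℝ)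
    (hx : ∑ u, x u = 0) (K R : ℝ) (hK : K = 2 * C + 10) (hR : R = ((d : ℝ) + 1) / (d - 1)) :
    ∑ u, x u ^ 2 ≤ ((1 + θ) ^ 2 * ((Fintype.card V : ℝ) ^ 2 / ((d - 1) * Real.pi ^ 2)) +
      ((1 + 1 / θ) * (2 * K ^ 2) + (1 + θ) * ((1 + θ) * ((d + 1) * R / 4) +
        (1 + 1 / θ) * (2 * C ^ 2 * K ^ 2) + C * (R + 2 * C * K ^ 2))) * Fintype.card V) *
      lapQ G x := by
  have hpi := Real.pi_pos
  have hd1' : (1 : ℝ) < d := by exact_mod_cast hd1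
  have hd0 : (0 : ℝ) < (d : ℝ) - 1 := by linarith
  have hR0 : 0 ≤ R := by rw [hR]; exact div_nonneg (by linarith) hd0.le
  have hK0 : 0 ≤ K := by rw [hK]; positivity
  obtain ⟨m, hmD, hmD'⟩ : ∃ m, 3 * (m + 1) ≤ D + 1 ∧ D ≤ 3 * (m + 1) + 1 :=
    ⟨(D + 1) / 3 - 1, by omega, by omega⟩
  set E := lapQ G x with hE
  have hE0 : 0 ≤ E := lapQ_nonneg G x
  have hs2 : Real.sqrt (2 * E) ^ 2 = 2 * E := Real.sq_sqrt (by positivity)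
  have hs0 := Real.sqrt_nonneg (2 * E)
  set P : ℝ := ((m + 1 : ℕ) : ℝ) with hP
  have hP0 : 0 < P := by rw [hP]; positivity
  set n : ℝ := (Fintype.card V : ℝ) with hn
  set c := (∑ p ∈ range (m + 1), layerAvg ℓ x (3 * p)) / P with hc
  set F : ℕ → ℝ := fun p => layerAvg ℓ x (3 * p) - c with hF
  have hFsum : ∑ p ∈ range (m + 1), F p = 0 := by
    rw [hF, Finset.sum_sub_distrib, Finset.sum_const, card_range, nsmul_eq_mul, hc,
      mul_div_cancel₀ _ hP0.ne', sub_self]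
  have hFd : ∀ k, F (k + 1) - F k = layerAvg ℓ x (3 * (k + 1)) - layerAvg ℓ x (3 * k) :=
    fun k => by simp only [hF]; ring
  set B := badBlock ℓ D d m with hB
  have hBsub : B ⊆ range m := Finset.filter_subset _ _
  have hBcard : (B.card : ℝ) ≤ C := by
    exact_mod_cast (card_badBlock_le ℓ D d m).trans (h.card_bad_le hd (by omega) hC)
  have hgood : ∑ k ∈ range m \ B, (F (k + 1) - F k) ^ 2 ≤ R * E := by
    simp only [hFd]
    rw [hR]
    exact h.sum_sq_good_le hd1 hd x m (by omega)
  have hstep : ∀ k ∈ B, |F (k + 1) - F k| ≤ K * Real.sqrt (2 * E) := by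
    intro k hk
    have := mem_range.1 (hBsub hk)
    rw [hFd, hK]
    exact h.abs_layerAvg_sub_layerAvg_le hd (by omega) hC x _ _ (by omega) (by omega) (by omega)
  have hbad1 : ∑ k ∈ B, |F (k + 1) - F k| ≤ C * (K * Real.sqrt (2 * E)) := by
    refine (Finset.sum_le_sum hstep).trans ?_
    rw [Finset.sum_const, nsmul_eq_mul]
    gcongr
  have hbad1' : (∑ k ∈ B, |F (k + 1) - F k|) ^ 2 ≤ C ^ 2 * K ^ 2 * (2 * E) := by
    have h0 : 0 ≤ ∑ k ∈ B, |F (k + 1) - F k| := Finset.sum_nonneg fun _ _ => abs_nonneg _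
    refine (pow_le_pow_left₀ h0 hbad1 2).trans (le_of_eq ?_)
    rw [mul_pow, mul_pow, hs2]; ring
  have hbad2 : ∑ k ∈ B, (F (k + 1) - F k) ^ 2 ≤ C * (K ^ 2 * (2 * E)) := by
    refine (Finset.sum_le_sum (g := fun _ => K ^ 2 * (2 * E)) fun k hk => ?_).trans ?_
    · rw [← sq_abs, ← hs2, ← mul_pow]
      exact pow_le_pow_left₀ (abs_nonneg _) (hstep k hk) 2
    · rw [Finset.sum_const, nsmul_eq_mul]
      gcongr
  have hall : ∑ k ∈ range m, (F (k + 1) - F k) ^ 2 ≤ (R + 2 * C * K ^ 2) * E := by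
    rw [← Finset.sum_sdiff hBsub]
    linarith
  have hN := discrete_neumann (m + 1) (by omega) F hFsum B (by simpa using hBsub) θ hθ
  rw [Nat.add_sub_cancel] at hN
  have hmax : ∀ p < m + 1, F p ^ 2 ≤ P * ((R + 2 * C * K ^ 2) * E) := by
    intro p hp
    have := sq_le_of_sum_eq_zero (m + 1) F hFsum p hp
    rw [Nat.add_sub_cancel] at this
    exact this.trans (by gcongr)
  obtain ⟨hPn, hblock⟩ := h.sum_block_le hd hC (P := m + 1) (by omega) hmD hmD'
    (fun p => F p ^ 2) (P * ((R + 2 * C * K ^ 2) * E)) (by positivity) hmax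
  have hPn : P * (d + 1) ≤ n := by rw [hP, hn]; exact_mod_cast hPn
  have hPn1 : P ≤ n := by nlinarith
  have hn1 : 1 ≤ n := by
    have : (1 : ℝ) ≤ P := by rw [hP]; push_cast; linarith [(Nat.cast_nonneg m : (0 : ℝ) ≤ m)]
    linarith
  have hA : ∑ u, (x u - layerAvg ℓ x (3 * block ℓ (m + 1) u)) ^ 2 ≤ n * (K ^ 2 * (2 * E)) := by
    refine (Finset.sum_le_sum (g := fun _ => K ^ 2 * (2 * E)) fun u _ => ?_).trans ?_
    · rw [← sq_abs, ← hs2, ← mul_pow, abs_sub_comm]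
      refine pow_le_pow_left₀ (abs_nonneg _) ?_ 2
      have := h.le u
      rw [hK]
      exact h.abs_layerAvg_sub_le hd (by omega) hC x u _ (by unfold block; omega)
        (by unfold block; omega)
    · rw [Finset.sum_const, nsmul_eq_mul, Finset.card_univ]
  have hcenter : ∑ u, x u ^ 2 ≤ ∑ u, (x u - c) ^ 2 := by
    have : ∑ u, (x u - c) ^ 2 = ∑ u, x u ^ 2 + n * c ^ 2 := by
      simp only [sub_sq, Finset.sum_add_distrib, Finset.sum_sub_distrib]
      rw [← Finset.sum_mul, ← Finset.mul_sum, hx]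
      simp [hn]
    rw [this]
    exact le_add_of_nonneg_right (by positivity)
  have hyoung : ∑ u, (x u - c) ^ 2 ≤
      (1 + θ) * ∑ u, F (block ℓ (m + 1) u) ^ 2 +
      (1 + 1 / θ) * ∑ u, (x u - layerAvg ℓ x (3 * block ℓ (m + 1) u)) ^ 2 := by
    rw [Finset.mul_sum, Finset.mul_sum, ← Finset.sum_add_distrib]
    refine Finset.sum_le_sum fun u _ => ?_
    refine le_trans (le_of_eq ?_) (add_sq_le_young θ hθ _ _)
    simp only [hF]; ring
  have hNE : ((d : ℝ) + 1) * ∑ p ∈ range (m + 1), F p ^ 2 ≤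
      (1 + θ) * (n ^ 2 / ((d - 1) * Real.pi ^ 2)) * E + (1 + θ) * ((d + 1) * R / 4) * n * E +
      (1 + 1 / θ) * (2 * C ^ 2 * K ^ 2) * n * E := by
    calc ((d : ℝ) + 1) * ∑ p ∈ range (m + 1), F p ^ 2 ≤
        ((d : ℝ) + 1) * ((1 + θ) * ((P ^ 2 / Real.pi ^ 2 + 1 / 4) * (R * E)) +
          (1 + 1 / θ) * (P * (C ^ 2 * K ^ 2 * (2 * E)))) := by
          gcongr
          refine hN.trans ?_
          gcongr
      _ = (1 + θ) * ((P * (d + 1)) ^ 2 / ((d - 1) * Real.pi ^ 2)) * E +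
          (1 + θ) * ((d + 1) * R / 4) * 1 * E +
          (1 + 1 / θ) * (2 * C ^ 2 * K ^ 2) * (P * (d + 1)) * E := by
          rw [hR]; field_simp
      _ ≤ _ := by gcongr
  have hCP : (C : ℝ) * (P * ((R + 2 * C * K ^ 2) * E)) ≤ C * (n * ((R + 2 * C * K ^ 2) * E)) := by
    gcongr
  calc ∑ u, x u ^ 2 ≤ _ := hcenter.trans hyoung
    _ ≤ (1 + θ) * ((1 + θ) * (n ^ 2 / ((d - 1) * Real.pi ^ 2)) * E +
        (1 + θ) * ((d + 1) * R / 4) * n * E + (1 + 1 / θ) * (2 * C ^ 2 * K ^ 2) * n * E +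
        C * (n * ((R + 2 * C * K ^ 2) * E))) + (1 + 1 / θ) * (n * (K ^ 2 * (2 * E))) := by
        gcongr
        linarith
    _ = _ := by ring

end IsLayering

/-- The distances to an endpoint of a diametral path form a layering. -/
theorem exists_isLayering {V : Type*} [Fintype V] (G : SimpleGraph V) (hG : G.Connected) :
    ∃ ℓ : V → ℕ, IsLayering G ℓ G.diam := by
  have := hG.nonempty
  obtain ⟨a, b, hab⟩ := G.exists_dist_eq_diam
  refine ⟨fun u => G.dist u a, ?_, ?_, ?_, ?_, ?_⟩
  · intro u v huv
    have h1 := hG.dist_triangle (u := v) (v := u) (w := a)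
    have h2 := SimpleGraph.dist_eq_one_iff_adj.2 huv.symm
    omega
  · intro u hu
    obtain ⟨p, hp⟩ := hG.exists_walk_length_eq_dist u a
    cases p with
    | nil => simp at hu
    | cons huv q =>
      rename_i v
      refine ⟨v, huv, ?_⟩
      have h1 := hG.dist_triangle (u := u) (v := v) (w := a)
      have h2 := SimpleGraph.dist_eq_one_iff_adj.2 huv
      have h3 := SimpleGraph.dist_le q
      rw [SimpleGraph.Walk.length_cons] at hp
      omega
  · intro u v hu hv
    rw [hG.dist_eq_zero_iff.1 hu, hG.dist_eq_zero_iff.1 hv]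
  · intro u
    exact SimpleGraph.dist_le_diam (SimpleGraph.connected_iff_ediam_ne_top.1 hG)
  · exact ⟨b, by rw [SimpleGraph.dist_comm, hab]⟩

/-- A lower bound for all Rayleigh quotients is a lower bound for the algebraic connectivity. -/
theorem le_algConn {V : Type*} [Fintype V] [Nontrivial V] (G : SimpleGraph V) (r : ℝ)
    (h : ∀ x : V → ℝ, 0 < ∑ v, x v ^ 2 → ∑ v, x v = 0 → r ≤ lapQ G x / ∑ v, x v ^ 2) :
    r ≤ algConn G := by
  classical
  apply le_csInf
  · obtain ⟨a, b, hab⟩ := exists_pair_ne V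
    refine ⟨_, Pi.single a 1 - Pi.single b 1, ?_, ?_, rfl⟩
    · intro h0
      have := congrFun h0 a
      simp [hab] at this
    · simp
  · rintro _ ⟨x, hx0, hx, rfl⟩
    refine h x ?_ hx
    obtain ⟨v, hv⟩ := Function.ne_iff.1 hx0
    exact Finset.sum_pos' (fun _ _ => sq_nonneg _) ⟨v, mem_univ v, by
      have : x v ≠ 0 := hv
      positivity⟩

/-- for every `d ≥ 3`, `c ≥ 0`, `ε > 0` there is `N` such that every connected
graph on `n ≥ N` vertices with minimum degree exactly `d` and `diam(G) ≥ 3n/(d+1) − c`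
satisfies `μ(G) ≥ (1−ε)·(d−1)·π²/n²`. -/
theorem statement15 (d : ℕ) (hd : 3 ≤ d) (c : ℝ) (hc : 0 ≤ c) (ε : ℝ) (hε : 0 < ε) :
    ∃ N : ℕ, ∀ n : ℕ, N ≤ n → ∀ G : SimpleGraph (Fin n), G.Connected →
      (∀ v, d ≤ (G.neighborSet v).ncard) → (∃ v, (G.neighborSet v).ncard = d) →
      3 * (n : ℝ) / ((d : ℝ) + 1) - c ≤ (G.diam : ℝ) →
      (1 - ε) * ((d : ℝ) - 1) * Real.pi ^ 2 / (n : ℝ) ^ 2 ≤ algConn G := by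
  obtain ⟨C, hCdef⟩ : ∃ C : ℕ, C = ⌈((d : ℝ) + 1) * (c + 1)⌉₊ := ⟨_, rfl⟩
  obtain ⟨K, hK⟩ : ∃ K : ℝ, K = 2 * C + 10 := ⟨_, rfl⟩
  obtain ⟨R, hR⟩ : ∃ R : ℝ, R = ((d : ℝ) + 1) / (d - 1) := ⟨_, rfl⟩
  obtain ⟨K₁, hK₁⟩ : ∃ K₁ : ℝ, K₁ = (1 + 1 / (ε / 6)) * (2 * K ^ 2) + (1 + ε / 6) *
      ((1 + ε / 6) * ((d + 1) * R / 4) + (1 + 1 / (ε / 6)) * (2 * C ^ 2 * K ^ 2) +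
        C * (R + 2 * C * K ^ 2)) := ⟨_, rfl⟩
  have hpi := Real.pi_pos
  have hd3 : (3 : ℝ) ≤ d := by exact_mod_cast hd
  have hd0 : (0 : ℝ) < (d : ℝ) - 1 := by linarith
  have hCle : ((d : ℝ) + 1) * (c + 1) ≤ C := by rw [hCdef]; exact Nat.le_ceil _
  refine ⟨⌈(5 + c) * ((d : ℝ) + 1)⌉₊ + ⌈2 * K₁ * ((d : ℝ) - 1) * Real.pi ^ 2 / ε⌉₊, ?_⟩
  intro n hn G hG hdeg _ hdiam
  have hn1 : (5 + c) * ((d : ℝ) + 1) ≤ n :=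
    (Nat.le_ceil _).trans (by exact_mod_cast (Nat.le_add_right _ _).trans hn)
  have hn2 : 2 * K₁ * ((d : ℝ) - 1) * Real.pi ^ 2 / ε ≤ n :=
    (Nat.le_ceil _).trans (by exact_mod_cast (Nat.le_add_left _ _).trans hn)
  have hn5 : (5 : ℝ) ≤ n := by nlinarith
  have hn5' : 5 ≤ n := by exact_mod_cast hn5
  have : Nontrivial (Fin n) := Fin.nontrivial_iff_two_le.2 (by omega)
  rw [sub_le_iff_le_add, div_le_iff₀ (by positivity)] at hdiam
  have hD : 5 ≤ G.diam := by
    have : (5 : ℝ) ≤ G.diam := by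
      have h1 : (5 + c) * ((d : ℝ) + 1) ≤ (G.diam + c) * (d + 1) := by linarith
      have := le_of_mul_le_mul_right h1 (by positivity)
      linarith
    exact_mod_cast this
  have hC : 3 * Fintype.card (Fin n) + (d + 1) ≤ G.diam * (d + 1) + C := by
    rw [Fintype.card_fin]
    have : (3 : ℝ) * n + (d + 1) ≤ G.diam * (d + 1) + C := by linarith
    exact_mod_cast this
  obtain ⟨ℓ, hℓ⟩ := exists_isLayering G hG
  refine le_algConn G _ fun x hS hx => ?_
  have hE0 := lapQ_nonneg G x
  rcases le_or_gt 1 ε with hε1 | hε1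
  · refine le_trans ?_ (div_nonneg hE0 hS.le)
    refine div_nonpos_of_nonpos_of_nonneg ?_ (by positivity)
    exact mul_nonpos_of_nonpos_of_nonneg
      (mul_nonpos_of_nonpos_of_nonneg (by linarith) hd0.le) (by positivity)
  have hmain := hℓ.sum_sq_le (by omega) hdeg hD hC (ε / 6) (by positivity) x hx K R hK hR
  rw [← hK₁, Fintype.card_fin] at hmain
  obtain ⟨Q, hQ⟩ : ∃ Q : ℝ, Q = (n : ℝ) ^ 2 / ((d - 1) * Real.pi ^ 2) := ⟨_, rfl⟩
  have hQ0 : 0 < Q := by rw [hQ]; positivity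
  have hK₁n : K₁ * n ≤ ε / 2 * Q := by
    rw [div_le_iff₀ hε] at hn2
    rw [hQ, ← mul_div_assoc, le_div_iff₀ (by positivity)]
    nlinarith
  have hlhs : (1 - ε) * ((d : ℝ) - 1) * Real.pi ^ 2 / (n : ℝ) ^ 2 = (1 - ε) / Q := by
    rw [hQ]; field_simp
  rw [← hQ] at hmain
  rw [hlhs, div_le_div_iff₀ hQ0 hS]
  have hfac : (1 + ε / 6) ^ 2 * Q + K₁ * n ≤ (1 + ε) * Q := by
    have : (1 + ε / 6) ^ 2 ≤ 1 + ε / 2 := by nlinarith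
    nlinarith
  have hS2 : ∑ v, x v ^ 2 ≤ (1 + ε) * Q * lapQ G x :=
    hmain.trans (mul_le_mul_of_nonneg_right hfac hE0)
  calc (1 - ε) * ∑ v, x v ^ 2 ≤ (1 - ε) * ((1 + ε) * Q * lapQ G x) :=
        mul_le_mul_of_nonneg_left hS2 (by linarith)
    _ = lapQ G x * Q - ε ^ 2 * (lapQ G x * Q) := by ring
    _ ≤ lapQ G x * Q := sub_le_self _ (by positivity)
end
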